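/- arXiv:1801.09849 — 2 statements merged into one kernel-verified Lean document; each statement's English description precedes it below -/
import Mathlib

section
/- Let $K_1 \subseteq \mathbb{R}^n$ and $K_2 \subseteq \mathbb{R}^m$ be proper cones and let $A$ be a real $m \times n$ matrix. If for every semipositive matrix $B$ (i.e. every real $m \times n$ matrix $B$ for which there exists $x$ in the interior of $K_1$ with $Bx$ in the interior of $K_2$) the matrix $A + B$ is semipositive, then $A$ is nonnegative, i.e. $A(K_1) \subseteq K_2$. -/
open Matrix Set

/-- A proper cone in `ℝ^n`: a convex cone that is closed, pointed and has
nonempty interior. -/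
def IsProperCone {n : ℕ} (K : Set (Fin n → ℝ)) : Prop :=
  (∀ x ∈ K, ∀ y ∈ K, x + y ∈ K) ∧
  (∀ a : ℝ, 0 ≤ a → ∀ x ∈ K, a • x ∈ K) ∧
  IsClosed K ∧
  K ∩ (-K) = {(0 : Fin n → ℝ)} ∧
  (interior K).Nonempty

/-- `A` is semipositive relative to the proper cones `K₁`, `K₂`. -/
def Semipositive {n m : ℕ} (K₁ : Set (Fin n → ℝ)) (K₂ : Set (Fin m → ℝ))
    (A : Matrix (Fin m) (Fin n) ℝ) : Prop :=
  ∃ x ∈ interior K₁, A.mulVec x ∈ interior K₂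

open scoped Pointwise

theorem IsProperCone.convex {n : ℕ} {K : Set (Fin n → ℝ)} (hK : IsProperCone K) :
    Convex ℝ K :=
  fun x hx y hy a b ha hb _ =>
    hK.1 _ (hK.2.1 a ha x hx) _ (hK.2.1 b hb y hy)

theorem IsProperCone.smul_mem_interior {n : ℕ} {K : Set (Fin n → ℝ)} (hK : IsProperCone K)
    {c : ℝ} (hc : 0 < c) {u : Fin n → ℝ} (hu : u ∈ interior K) : c • u ∈ interior K := by
  have hsub : c • K ⊆ K := by
    rintro _ ⟨x, hx, rfl⟩
    exact hK.2.1 c hc.le x hx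
  apply interior_mono hsub
  rw [interior_smul₀ hc.ne']
  exact smul_mem_smul_set hu

/-- A point outside a proper cone is separated from it by a functional that is positive on the
interior of the cone. -/
theorem IsProperCone.exists_separating {n : ℕ} {K : Set (Fin n → ℝ)} (hK : IsProperCone K)
    {b : Fin n → ℝ} (hb : b ∉ K) :
    ∃ φ : (Fin n → ℝ) →L[ℝ] ℝ, φ b < 0 ∧ ∀ z ∈ interior K, 0 < φ z := by
  obtain ⟨φ, r, hbr, hr⟩ := geometric_hahn_banach_point_closed hK.convex hK.2.2.1 hb
  obtain ⟨e, he⟩ := hK.2.2.2.2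
  have hr0 : r < 0 := by
    simpa using hr _ (hK.2.1 0 le_rfl e (interior_subset he))
  have hnonneg : ∀ z ∈ K, 0 ≤ φ z := by
    intro z hz
    by_contra! hneg
    have h := hr _ (hK.2.1 (r / φ z) (div_nonneg_of_nonpos hr0.le hneg.le) z hz)
    rw [map_smul, smul_eq_mul, div_mul_cancel₀ _ hneg.ne] at h
    exact lt_irrefl _ h
  have hφb : φ b < 0 := hbr.trans hr0
  refine ⟨φ, hφb, fun z hz => ?_⟩
  have hcont : Filter.Tendsto (fun t : ℝ => z + t • b) (nhdsWithin 0 (Ioi 0)) (nhds z) := by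
    have h : Continuous fun t : ℝ => z + t • b := by fun_prop
    simpa using (h.tendsto 0).mono_left nhdsWithin_le_nhds
  obtain ⟨t, htK, ht⟩ :=
    ((hcont.eventually (mem_interior_iff_mem_nhds.mp hz)).and self_mem_nhdsWithin).exists
  have h := hnonneg _ htK
  rw [map_add, map_smul, smul_eq_mul] at h
  nlinarith [mul_neg_of_pos_of_neg (show 0 < t from ht) hφb]

theorem stmt_1 {n m : ℕ} (K₁ : Set (Fin n → ℝ)) (K₂ : Set (Fin m → ℝ))
    (hK₁ : IsProperCone K₁) (hK₂ : IsProperCone K₂)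
    (A : Matrix (Fin m) (Fin n) ℝ)
    (hA : ∀ B : Matrix (Fin m) (Fin n) ℝ, Semipositive K₁ K₂ B → Semipositive K₁ K₂ (A + B)) :
    ∀ x ∈ K₁, A.mulVec x ∈ K₂ := by
  have hint : interior K₁ ⊆ A.mulVec ⁻¹' K₂ := by
    intro x hx
    by_contra hAx
    obtain ⟨φ, hφ, hpos⟩ := hK₂.exists_separating hAx
    obtain ⟨u, hu⟩ := hK₂.2.2.2.2
    have hφu := hpos u hu
    -- The rank-one matrix `B` with `φ (B y) = -φ (A y)` and range spanned by `u`.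
    let B : Matrix (Fin m) (Fin n) ℝ := LinearMap.toMatrix'
      (((-(φ u)⁻¹) • (φ.toLinearMap ∘ₗ A.mulVecLin)).smulRight u)
    have hB : ∀ y, B.mulVec y = (-(φ u)⁻¹ * φ (A.mulVec y)) • u := by
      intro y
      simp [B, LinearMap.toMatrix'_mulVec]
    obtain ⟨y, -, hy⟩ := hA B ⟨x, hx, by
      rw [hB]
      exact hK₂.smul_mem_interior (mul_pos_of_neg_of_neg (by simpa using hφu) hφ) hu⟩
    have h := hpos _ hy
    rw [Matrix.add_mulVec, hB, map_add, map_smul, smul_eq_mul] at h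
    field_simp at h
    simp at h
  have hclosed : IsClosed (A.mulVec ⁻¹' K₂) :=
    hK₂.2.2.1.preimage (Continuous.matrix_mulVec continuous_const continuous_id)
  intro x hx
  apply closure_minimal hint hclosed
  rw [hK₁.convex.closure_interior_eq_closure_of_nonempty_interior hK₁.2.2.2.2]
  exact subset_closure hx
end

section
/- For any proper cone $K \subseteq \mathbb{R}^n$, the set $\pi(K)$ of all real $n \times n$ matrices $A$ with $A(K) \subseteq K$ is a proper cone in the space $M_n(\mathbb{R})$ of real $n \times n$ matrices (with the trace inner product $\langle X, Y \rangle = \mathrm{trace}(Y^t X)$): it is a topologically closed, pointed convex cone with nonempty interior. -/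
open Matrix Set

/-- The set `π(K)` of `K`-nonnegative matrices. -/
def nonnegativeSet {n : ℕ} (K : Set (Fin n → ℝ)) : Set (Matrix (Fin n) (Fin n) ℝ) :=
  {A | ∀ x ∈ K, A.mulVec x ∈ K}

open Filter Topology

/-- On a closed salient cone in a finite-dimensional space some continuous linear functional is
strictly positive away from the origin. -/
theorem ProperCone.exists_strongDual_pos {E : Type*} [NormedAddCommGroup E] [NormedSpace ℝ E]
    [FiniteDimensional ℝ E] (C : ProperCone ℝ E) (hC : ∀ x ∈ C, -x ∈ C → x = 0) :
    ∃ f : StrongDual ℝ E, ∀ x ∈ C, x ≠ 0 → 0 < f x := by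
  have : ProperSpace E := FiniteDimensional.proper ℝ E
  have hcomp : IsCompact (Metric.sphere (0 : E) 1 ∩ C) :=
    (isCompact_sphere 0 1).inter_right C.isClosed
  obtain ⟨f, -, hf⟩ : ∃ f : StrongDual ℝ E, (∀ x ∈ C, 0 ≤ f x) ∧
      ∀ x ∈ Metric.sphere (0 : E) 1 ∩ C, 0 < f x := by
    refine hcomp.induction_on (p := fun s ↦ ∃ f : StrongDual ℝ E, (∀ x ∈ C, 0 ≤ f x) ∧
      ∀ x ∈ s ∩ C, 0 < f x) ⟨0, by simp⟩ ?_ ?_ ?_ |>.imp fun f hf ↦ ⟨hf.1, fun x hx ↦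
        hf.2 x ⟨hx, hx.2⟩⟩
    · rintro s t hst ⟨f, hf, hft⟩
      exact ⟨f, hf, fun x hx ↦ hft x ⟨hst hx.1, hx.2⟩⟩
    · rintro s t ⟨f, hf, hfs⟩ ⟨g, hg, hgt⟩
      refine ⟨f + g, fun x hx ↦ add_nonneg (hf x hx) (hg x hx), ?_⟩
      rintro x ⟨hx | hx, hxC⟩
      · exact add_pos_of_pos_of_nonneg (hfs x ⟨hx, hxC⟩) (hg x hxC)
      · exact add_pos_of_nonneg_of_pos (hf x hxC) (hgt x ⟨hx, hxC⟩)
    · rintro x ⟨hx, hxC⟩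
      have hx0 : x ≠ 0 := ne_zero_of_mem_unit_sphere ⟨x, hx⟩
      obtain ⟨f, hf, hfx⟩ := C.hyperplane_separation_point fun h ↦ hx0 (hC x hxC h)
      rw [map_neg, neg_lt_zero] at hfx
      exact ⟨{y | 0 < f y}, mem_nhdsWithin_of_mem_nhds
        ((isOpen_lt continuous_const f.continuous).mem_nhds hfx), f, hf, fun y hy ↦ hy.1⟩
  refine ⟨f, fun x hxC hx ↦ ?_⟩
  have h := hf (‖x‖⁻¹ • x) ⟨by simp [norm_smul, hx], C.smul_mem hxC (by positivity)⟩
  rw [map_smul, smul_eq_mul] at h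
  exact pos_of_mul_pos_right h (by positivity)

variable {n : ℕ} {K : Set (Fin n → ℝ)}

namespace IsProperCone

theorem zero_mem (hK : IsProperCone K) : (0 : Fin n → ℝ) ∈ K :=
  (hK.2.2.2.1.ge rfl).1

theorem eq_zero_of_neg_mem (hK : IsProperCone K) {x : Fin n → ℝ} (hx : x ∈ K) (hx' : -x ∈ K) :
    x = 0 :=
  hK.2.2.2.1.le ⟨hx, hx'⟩

open scoped Pointwise in
theorem smul_mem_interior_s17 (hK : IsProperCone K) {u : Fin n → ℝ} (hu : u ∈ interior K) {c : ℝ}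
    (hc : 0 < c) : c • u ∈ interior K := by
  have h : c • interior K ⊆ interior K := by
    rw [← interior_smul₀ hc.ne']
    refine interior_mono ?_
    rintro _ ⟨x, hx, rfl⟩
    exact hK.2.1 c hc.le x hx
  exact h ⟨u, hu, rfl⟩

theorem exists_strongDual_pos (hK : IsProperCone K) :
    ∃ f : StrongDual ℝ (Fin n → ℝ), ∀ x ∈ K, x ≠ 0 → 0 < f x :=
  ProperCone.exists_strongDual_pos
    (C := { carrier := K
            add_mem' := fun hx hy ↦ hK.1 _ hx _ hy
            zero_mem' := hK.zero_mem
            smul_mem' := fun c _ hx ↦ hK.2.1 c c.2 _ hx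
            isClosed' := hK.2.2.1 })
    fun _ ↦ hK.eq_zero_of_neg_mem

/-- A matrix which vanishes on a cone with nonempty interior is zero. -/
theorem eq_zero_of_mulVec_eq_zero (hK : IsProperCone K) {A : Matrix (Fin n) (Fin n) ℝ}
    (hA : ∀ x ∈ K, A *ᵥ x = 0) : A = 0 := by
  obtain ⟨u, hu⟩ := hK.2.2.2.2
  refine Matrix.ext_of_mulVec_single fun i ↦ ?_
  set v : Fin n → ℝ := Pi.single i 1
  have hlim : Tendsto (fun t : ℝ ↦ u + t • v) (𝓝[>] 0) (𝓝 u) := by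
    have : Continuous fun t : ℝ ↦ u + t • v := by fun_prop
    simpa using (this.tendsto 0).mono_left nhdsWithin_le_nhds
  obtain ⟨t, htK, ht⟩ :=
    ((hlim.eventually (mem_interior_iff_mem_nhds.1 hu)).and self_mem_nhdsWithin).exists
  have h := hA _ htK
  rw [mulVec_add, hA u (interior_subset hu), zero_add, mulVec_smul] at h
  simpa using (smul_eq_zero.1 h).resolve_left (ne_of_gt ht)

/-- A matrix mapping the nonzero vectors of `K` into the interior of `K` is interior to `π(K)`. -/
theorem mem_interior_nonnegativeSet (hK : IsProperCone K) {A : Matrix (Fin n) (Fin n) ℝ}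
    (hA : ∀ x ∈ K, x ≠ 0 → A *ᵥ x ∈ interior K) : A ∈ interior (nonnegativeSet K) := by
  have hcomp : IsCompact (Metric.sphere (0 : Fin n → ℝ) 1 ∩ K) :=
    (isCompact_sphere 0 1).inter_right hK.2.2.1
  have hcont : Continuous fun z : Matrix (Fin n) (Fin n) ℝ × (Fin n → ℝ) ↦ z.1 *ᵥ z.2 :=
    continuous_fst.matrix_mulVec continuous_snd
  rw [mem_interior_iff_mem_nhds]
  filter_upwards [hcomp.eventually_forall_of_forall_eventually (x₀ := A)
    (P := fun B x ↦ B *ᵥ x ∈ interior K) fun x hx ↦ (isOpen_interior.preimage hcont).mem_nhds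
      (hA x hx.2 (ne_zero_of_mem_unit_sphere ⟨x, hx.1⟩))] with B hB x hxK
  obtain rfl | hx := eq_or_ne x 0
  · simpa using hK.zero_mem
  · have h := interior_subset <| hB (‖x‖⁻¹ • x)
      ⟨by simp [norm_smul, hx], hK.2.1 _ (by positivity) _ hxK⟩
    simpa [mulVec_smul, smul_smul, hx] using hK.2.1 ‖x‖ (norm_nonneg x) _ h

theorem nonempty_interior_nonnegativeSet (hK : IsProperCone K) :
    (interior (nonnegativeSet K)).Nonempty := by
  obtain ⟨u, hu⟩ := hK.2.2.2.2
  obtain ⟨f, hf⟩ := hK.exists_strongDual_pos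
  refine ⟨LinearMap.toMatrix' (f.smulRight u : (Fin n → ℝ) →ₗ[ℝ] Fin n → ℝ),
    hK.mem_interior_nonnegativeSet fun x hxK hx ↦ ?_⟩
  rw [LinearMap.toMatrix'_mulVec]
  exact hK.smul_mem_interior_s17 hu (hf x hxK hx)

end IsProperCone

theorem isClosed_nonnegativeSet (hK : IsClosed K) : IsClosed (nonnegativeSet K) := by
  simp only [nonnegativeSet, ofPred_forall]
  exact isClosed_biInter fun x _ ↦ hK.preimage (continuous_id.matrix_mulVec continuous_const)

/-- `π(K)` is a proper cone in `Mₙ(ℝ)`: it is a closed pointed convex cone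
with nonempty interior. -/
theorem stmt_17 {n : ℕ} (K : Set (Fin n → ℝ)) (hK : IsProperCone K) :
    (∀ A ∈ nonnegativeSet K, ∀ B ∈ nonnegativeSet K, A + B ∈ nonnegativeSet K) ∧
    (∀ a : ℝ, 0 ≤ a → ∀ A ∈ nonnegativeSet K, a • A ∈ nonnegativeSet K) ∧
    IsClosed (nonnegativeSet K) ∧
    nonnegativeSet K ∩ (-(nonnegativeSet K)) = {(0 : Matrix (Fin n) (Fin n) ℝ)} ∧
    (interior (nonnegativeSet K)).Nonempty := by
  refine ⟨fun A hA B hB x hx ↦ ?_, fun a ha A hA x hx ↦ ?_, isClosed_nonnegativeSet hK.2.2.1, ?_,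
    hK.nonempty_interior_nonnegativeSet⟩
  · rw [add_mulVec]
    exact hK.1 _ (hA x hx) _ (hB x hx)
  · rw [smul_mulVec]
    exact hK.2.1 a ha _ (hA x hx)
  · refine Subset.antisymm (fun A hA ↦ hK.eq_zero_of_mulVec_eq_zero fun x hx ↦
      hK.eq_zero_of_neg_mem (hA.1 x hx) ?_) ?_
    · simpa only [neg_mulVec] using hA.2 x hx
    · rintro _ rfl
      constructor <;> intro x _ <;> simpa using hK.zero_mem
end
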